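/- Fix n, T, D. Let X = Σ^{D·T+1} with Σ = {0,1}, F = {f₀, f₁, ..., f_D} where f₀ ≡ 0 and f_d(x) = x[−d·T] (the (d·T)-th symbol from the end), P_x uniform on X, and π_SFT(y|x) uniform over Σ^{T−1} × {last symbol = 0}. Then the empirical next-token losses satisfy: L̂(f₀) ∼ Bin(n(T−1), 1/2), L̂(f_d) ∼ Bin(nT, 1/2) for 1 ≤ d ≤ D, and the random variables L̂(f₀), L̂(f₁), ..., L̂(f_D) are mutually independent. -/

import Mathlib

noncomputable def ntpB (ι : Type) [Fintype ι] [DecidableEq ι] (g : ℕ → ℝ) : ℝ :=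
  (1 / 2 : ℝ) ^ (Fintype.card ι) * ∑ u : ι → Bool, g (∑ i, if u i = true then 1 else 0)

lemma ntpB_one (ι : Type) [Fintype ι] [DecidableEq ι] : ntpB ι (fun _ => 1) = 1 := by
  simp [ntpB]

lemma ntpB_ind (ι : Type) [Fintype ι] [DecidableEq ι] (k : ℕ) :
    ntpB ι (fun j => if j = k then 1 else 0) =
      ((Fintype.card ι).choose k : ℝ) * (1 / 2 : ℝ) ^ (Fintype.card ι) := by
  unfold ntpB
  rw [mul_comm]
  congr 1
  rw [Finset.sum_boole]
  norm_cast
  rw [← Finset.card_univ, ← Finset.card_powersetCard]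
  refine Finset.card_bij' (fun u _ => Finset.univ.filter (fun i => u i = true))
    (fun s _ => fun i => decide (i ∈ s)) ?_ ?_ ?_ ?_
  · intro u hu
    simpa [Finset.mem_powersetCard] using hu
  · intro s hs
    simpa [Finset.mem_powersetCard] using hs
  · intro u hu
    ext i
    simp
  · intro s hs
    ext i
    simp

/-- the change of variables -/
def ntpE (n m D : ℕ) :
    ((Fin n → Bool) × (Fin n → Bool)) × ((Fin n × Fin m → Bool) × (Fin D → Fin n × Fin (m + 1) → Bool)) ≃
      (Fin n → ((Fin (D * (m + 1) + 1) → Bool) × (Fin (m + 1) → Bool))) where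
  toFun p := fun i =>
    (Fin.cons (p.1.1 i) (fun j => xor (p.2.2 (finProdFinEquiv.symm j).1 (i, (finProdFinEquiv.symm j).2))
      ((Fin.snoc (fun t => p.2.1 (i, t)) (p.1.2 i) : Fin (m + 1) → Bool) (finProdFinEquiv.symm j).2)),
     Fin.snoc (fun t => p.2.1 (i, t)) (p.1.2 i))
  invFun ω := ((fun i => (ω i).1 0, fun i => (ω i).2 (Fin.last m)),
    (fun q => (ω q.1).2 q.2.castSucc,
     fun a q => xor ((ω q.1).1 (finProdFinEquiv (a, q.2)).succ) ((ω q.1).2 q.2)))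
  left_inv := by
    rintro ⟨⟨b, l⟩, v, z⟩
    simp only [Fin.cons_zero, Fin.snoc_last, Fin.snoc_castSucc, Fin.cons_succ,
      Equiv.symm_apply_apply, Prod.mk.eta, Bool.xor_assoc, Bool.xor_self, Bool.xor_false]
  right_inv := by
    intro ω
    funext i
    have h : (Fin.snoc (fun t : Fin m => (ω i).2 t.castSucc) ((ω i).2 (Fin.last m)) : Fin (m + 1) → Bool)
        = (ω i).2 := Fin.snoc_init_self (ω i).2
    refine Prod.ext ?_ h
    simp only [h]
    funext j
    refine Fin.cases ?_ (fun j => ?_) j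
    · simp
    · simp only [Fin.cons_succ, Prod.mk.eta, Equiv.apply_symm_apply, Bool.xor_assoc, Bool.xor_self, Bool.xor_false]

lemma ntp_getD {N : ℕ} (f : Fin N → Bool) (j : Fin N) : (List.ofFn f).getD j false = f j := by
  rw [List.getD_eq_getElem _ _ (by rw [List.length_ofFn]; exact j.2), List.getElem_ofFn]

lemma ntp_key (n m D : ℕ) (g0 : ℕ → ℝ) (g : Fin D → ℕ → ℝ) :
    ∑ ω : Fin n → ((Fin (D * (m + 1) + 1) → Bool) × (Fin (m + 1) → Bool)),
      (∏ i, (((1 : ℝ) / 2) ^ (D * (m + 1) + 1) *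
        (if (ω i).2 (Fin.last m) = false then ((1 : ℝ) / 2) ^ m else 0))) *
      (g0 (∑ i, ∑ t, if (ω i).2 t = true then 1 else 0) *
        ∏ a, g a (∑ i, ∑ t, if (ω i).1 (finProdFinEquiv (a, t)).succ ≠ (ω i).2 t then 1 else 0))
    = ntpB (Fin n × Fin m) g0 * ∏ a, ntpB (Fin n × Fin (m + 1)) (g a) := by
  have hx : ∀ a b : Bool, (xor a b ≠ b) ↔ a = true := by decide
  rw [← Equiv.sum_comp (ntpE n m D), Fintype.sum_prod_type, Fintype.sum_prod_type]
  have h1 : ∀ b : Fin n → Bool, ∀ F : (Fin n → Bool) → ℝ, (∀ l, l ≠ (fun _ => false) → F l = 0) →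
      ∑ l, F l = F (fun _ => false) := fun b F h => Fintype.sum_eq_single _ h
  have h3 : ∀ b : Fin n → Bool, _ = _ := fun b => h1 b
    (fun l => ∑ x : (Fin n × Fin m → Bool) × (Fin D → Fin n × Fin (m + 1) → Bool),
      (∏ i, (((1 : ℝ) / 2) ^ (D * (m + 1) + 1) *
        (if l i = false then ((1 : ℝ) / 2) ^ m else 0))) *
      (g0 (∑ i, ∑ t, if (Fin.snoc (fun t => x.1 (i, t)) (l i) : Fin (m + 1) → Bool) t = true then 1 else 0) *
        ∏ a, g a (∑ i, ∑ t, if x.2 a (i, t) = true then 1 else 0))) (by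
      intro l hl
      obtain ⟨i, hi⟩ := Function.ne_iff.mp hl
      refine Finset.sum_eq_zero fun x _ => ?_
      rw [Finset.prod_eq_zero (Finset.mem_univ i), zero_mul]
      simp [hi])
  refine (Finset.sum_congr rfl (fun b _ => Eq.trans ?_ (h3 b))).trans ?_
  · refine Finset.sum_congr rfl fun l _ => Finset.sum_congr rfl fun x _ => ?_
    have e2 : ∀ i, (ntpE n m D ((b, l), x) i).2 = Fin.snoc (fun t => x.1 (i, t)) (l i) := fun i => rfl
    have e1 : ∀ i a t, (ntpE n m D ((b, l), x) i).1 (finProdFinEquiv (a, t)).succ =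
        xor (x.2 a (i, t)) ((ntpE n m D ((b, l), x) i).2 t) := by
      intro i a t
      simp only [ntpE, Equiv.coe_fn_mk, Fin.cons_succ, Equiv.symm_apply_apply]
    have e3 : ∀ i, (ntpE n m D ((b, l), x) i).2 (Fin.last m) = l i := fun i => by
      rw [e2, Fin.snoc_last]
    congr 1
    · refine Finset.prod_congr rfl fun i _ => ?_
      rw [e3]
    · congr 1
      refine Finset.prod_congr rfl fun a _ => ?_
      congr 1
      refine Finset.sum_congr rfl fun i _ => Finset.sum_congr rfl fun t _ => ?_
      rw [e1]
      exact if_congr (hx _ _) rfl rfl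
  rw [Finset.sum_const]
  have h4 : ∀ (v : Fin n × Fin m → Bool) (i : Fin n),
      (∑ t, if (Fin.snoc (fun t => v (i, t)) false : Fin (m + 1) → Bool) t = true then 1 else 0) =
      ∑ t, if v (i, t) = true then 1 else 0 := by
    intro v i
    rw [Fin.sum_univ_castSucc]
    simp
  simp only [if_true, Finset.prod_const, h4]
  rw [← Finset.mul_sum]
  have h6 : ∀ (F : (Fin n × Fin m → Bool) → ℝ) (G : (Fin D → Fin n × Fin (m + 1) → Bool) → ℝ),
      ∑ x : (Fin n × Fin m → Bool) × (Fin D → Fin n × Fin (m + 1) → Bool), F x.1 * G x.2 =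
        (∑ v, F v) * ∑ z, G z := by
    intro F G
    rw [Fintype.sum_prod_type, Finset.sum_mul_sum]
  rw [h6 (fun v => g0 (∑ i, ∑ t, if v (i, t) = true then 1 else 0))
    (fun z => ∏ a, g a (∑ i, ∑ t, if z a (i, t) = true then 1 else 0))]
  have h5 := Finset.prod_univ_sum (fun _ : Fin D => (Finset.univ : Finset (Fin n × Fin (m + 1) → Bool)))
    (fun a u => g a (∑ i, ∑ t, if u (i, t) = true then 1 else 0))
  rw [Fintype.piFinset_univ] at h5
  rw [← h5]
  simp only [ntpB, Fintype.sum_prod_type, Finset.prod_mul_distrib, Finset.prod_const, Finset.card_univ,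
    Fintype.card_prod, Fintype.card_fin, Fintype.card_fun, Fintype.card_bool]
  simp
  have h7 : (2 : ℝ) ^ n * ((2 ^ (D * (m + 1) + 1))⁻¹ * (2 ^ m)⁻¹) ^ n =
      (2 ^ (n * m))⁻¹ * ((2 ^ (n * (m + 1))) ^ D)⁻¹ := by
    have e : (2 : ℝ) ^ n * (2 ^ (n * m) * (2 ^ (n * (m + 1))) ^ D) =
        (2 ^ (D * (m + 1) + 1) * 2 ^ m) ^ n := by
      simp only [← pow_mul, ← pow_add]
      congr 1
      ring
    rw [← mul_inv, ← mul_inv, inv_pow, ← e]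
    field_simp
  rw [← mul_assoc, h7]
  ring

open Classical in
/-- distribution and independence of the empirical next-token losses.
Prompts are uniform bit strings of length `D·T+1`, responses are uniform over
`Σ^{T−1} × {last = 0}`; the class is `F = {f₀, f₁, ..., f_D}` with `f₀ ≡ 0` and
`f_d(σ) = σ[−d·T]` (the `(d·T)`-th symbol from the end). Then
`L̂(f₀) ∼ Bin(n(T−1), 1/2)`, `L̂(f_d) ∼ Bin(nT, 1/2)` for `1 ≤ d ≤ D`, and
`L̂(f₀), ..., L̂(f_D)` are mutually independent. -/
theorem empirical_ntp_losses_binomial_and_independent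
    (n T D : ℕ) (hT : 0 < T) (hn : 0 < n) :
    let Ω := Fin n → ((Fin (D * T + 1) → Bool) × (Fin T → Bool))
    let w : Ω → ℝ := fun ω => ∏ i,
      (((1 : ℝ) / 2) ^ (D * T + 1) *
        (if (ω i).2 ⟨T - 1, Nat.sub_lt hT Nat.one_pos⟩ = false
         then ((1 : ℝ) / 2) ^ (T - 1) else 0))
    let fd : ℕ → List Bool → Bool := fun d σ =>
      if d = 0 then false else σ.getD (σ.length - d * T) false
    let L : ℕ → Ω → ℕ := fun d ω => ∑ i, ∑ t ∈ Finset.range T,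
      if fd d (List.ofFn (ω i).1 ++ (List.ofFn (ω i).2).take t) ≠
         (List.ofFn (ω i).2).getD t false then 1 else 0
    let Pr : (Ω → Prop) → ℝ := fun E => ∑ ω : Ω, w ω * (if E ω then 1 else 0)
    (∀ k : ℕ, Pr (fun ω => L 0 ω = k) =
        ((n * (T - 1)).choose k : ℝ) * ((1 : ℝ) / 2) ^ (n * (T - 1))) ∧
    (∀ d : ℕ, 1 ≤ d → d ≤ D → ∀ k : ℕ, Pr (fun ω => L d ω = k) =
        ((n * T).choose k : ℝ) * ((1 : ℝ) / 2) ^ (n * T)) ∧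
    (∀ k : ℕ → ℕ, Pr (fun ω => ∀ d ≤ D, L d ω = k d) =
        ∏ d ∈ Finset.range (D + 1), Pr (fun ω => L d ω = k d)) := by
  obtain ⟨m, rfl⟩ : ∃ m, T = m + 1 := ⟨T - 1, by omega⟩
  intro Ω w fd L Pr
  have hL0 : ∀ ω : Ω, L 0 ω = ∑ i, ∑ t, if (ω i).2 t = true then 1 else 0 := by
    intro ω
    refine Finset.sum_congr rfl fun i _ => ?_
    rw [Finset.sum_range]
    refine Finset.sum_congr rfl fun t _ => ?_
    have : (List.ofFn (ω i).2).getD t false = (ω i).2 t := by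
      exact ntp_getD _ _
    rw [this]
    simp only [fd, if_true]
    refine if_congr ?_ rfl rfl
    cases (ω i).2 t <;> simp
  have hLd : ∀ (a : Fin D) (ω : Ω), L (D - a) ω =
      ∑ i, ∑ t, if (ω i).1 (finProdFinEquiv (a, t)).succ ≠ (ω i).2 t then 1 else 0 := by
    intro a ω
    refine Finset.sum_congr rfl fun i _ => ?_
    rw [Finset.sum_range]
    refine Finset.sum_congr rfl fun t _ => ?_
    have h1 : (List.ofFn (ω i).2).getD t false = (ω i).2 t := by
      exact ntp_getD _ _
    have h2 : fd (D - a) (List.ofFn (ω i).1 ++ (List.ofFn (ω i).2).take t) =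
        (ω i).1 (finProdFinEquiv (a, t)).succ := by
      have ha := a.2
      have hd : D - (a : ℕ) ≠ 0 := by omega
      have hj := (finProdFinEquiv (a, t)).succ.2
      have hv : (finProdFinEquiv (a, t)).succ.val = t + (m + 1) * a + 1 := rfl
      have hlen : (List.ofFn (ω i).1 ++ (List.ofFn (ω i).2).take t).length - (D - a) * (m + 1) =
          (finProdFinEquiv (a, t)).succ.val := by
        have ht := t.2
        obtain ⟨c, hc⟩ : ∃ c, D = a + c := ⟨D - a, by omega⟩
        have h3 : D - (a : ℕ) = c := by omega
        have h4 : D * (m + 1) = (m + 1) * a + c * (m + 1) := by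
          calc D * (m + 1) = (a + c) * (m + 1) := congrArg (· * (m + 1)) hc
            _ = _ := by ring
        rw [hv, h3]
        simp only [List.length_append, List.length_ofFn, List.length_take]
        omega
      simp only [fd, if_neg hd, hlen]
      rw [List.getD_append _ _ _ _ (by simpa using hj), ntp_getD]
    rw [h1, h2]
  have hPr : ∀ (E : Ω → Prop) (g0 : ℕ → ℝ) (g : Fin D → ℕ → ℝ),
      (∀ ω, (if E ω then (1 : ℝ) else 0) = g0 (L 0 ω) * ∏ a : Fin D, g a (L (D - a) ω)) →
      Pr E = ntpB (Fin n × Fin m) g0 * ∏ a, ntpB (Fin n × Fin (m + 1)) (g a) := by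
    intro E g0 g h
    rw [← ntp_key]
    refine Finset.sum_congr rfl fun ω _ => ?_
    rw [h, hL0]
    simp only [hLd]
    rfl
  have hP0 : ∀ k, Pr (fun ω => L 0 ω = k) = ntpB (Fin n × Fin m) (fun j => if j = k then 1 else 0) := by
    intro k
    rw [hPr _ (fun j => if j = k then 1 else 0) (fun _ _ => 1) (by intro ω; simp)]
    simp [ntpB_one]
  have hPd : ∀ (a : Fin D) k, Pr (fun ω => L (D - a) ω = k) =
      ntpB (Fin n × Fin (m + 1)) (fun j => if j = k then 1 else 0) := by
    intro a k
    rw [hPr _ (fun _ => 1) (fun b j => if b = a then (if j = k then 1 else 0) else 1) ?_]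
    · rw [ntpB_one, one_mul, Finset.prod_eq_single a]
      · simp
      · intro b _ hb
        simp [hb, ntpB_one]
      · simp
    · intro ω
      rw [one_mul, Finset.prod_eq_single a]
      · simp
      · intro b _ hb
        simp [hb]
      · simp
  refine ⟨?_, ?_, ?_⟩
  · intro k
    rw [hP0, ntpB_ind]
    simp
  · intro d h1 h2 k
    have := hPd ⟨D - d, by omega⟩ k
    simp only [Nat.sub_sub_self h2] at this
    rw [this, ntpB_ind]
    simp
  · intro k
    rw [hPr _ (fun j => if j = k 0 then 1 else 0) (fun a j => if j = k (D - a) then 1 else 0) ?_]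
    · rw [Finset.prod_range_succ', hP0, mul_comm, ← Finset.prod_range_reflect, Finset.prod_range]
      congr 1
      refine Finset.prod_congr rfl fun a _ => ?_
      have : D - 1 - (a : ℕ) + 1 = D - a := by have := a.2; omega
      rw [this, hPd]
    · intro ω
      rw [Fintype.prod_boole, ite_zero_mul_ite_zero, one_mul]
      have hiff : (∀ d ≤ D, L d ω = k d) ↔ (L 0 ω = k 0 ∧ ∀ a : Fin D, L (D - a) ω = k (D - a)) := by
        constructor
        · intro h
          exact ⟨h 0 (Nat.zero_le _), fun a => h _ (Nat.sub_le _ _)⟩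
        · rintro ⟨h0, h⟩ d hd
          rcases Nat.eq_zero_or_pos d with rfl | hp
          · exact h0
          · have := h ⟨D - d, by omega⟩
            simpa only [Nat.sub_sub_self hd] using this
      by_cases h : ∀ d ≤ D, L d ω = k d
      · rw [if_pos h, if_pos (hiff.1 h)]
      · rw [if_neg h, if_neg (fun h' => h (hiff.2 h'))]
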